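/- If T is a tree, then its Thue chromatic number satisfies π(T) ≤ 4, and this bound is tight: there exists a tree T with π(T) = 4. -/

import Mathlib

/-- A list `l` is a repetition if it is some nonempty block repeated twice. -/
def IsRepetition {α : Type*} (l : List α) : Prop :=
  ∃ w : List α, w ≠ [] ∧ l = w ++ w

/-- A vertex coloring `c` of a graph `G` is nonrepetitive if there is no path
`v₁, …, v_{2t}` in `G` such that `v_i` and `v_{t+i}` receive the same color for all
`i = 1, …, t`; equivalently, the color sequence along any path is not a repetition. -/
def NonrepColoring {V : Type*} {α : Type*} (G : SimpleGraph V) (c : V → α) : Prop :=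
  ∀ (u v : V) (p : G.Walk u v), p.IsPath → ¬ IsRepetition (p.support.map c)

/-- The Thue chromatic number of a graph `G`: the minimum number of colors needed in
a nonrepetitive coloring of `G`. -/
noncomputable def thueNumber {V : Type*} (G : SimpleGraph V) : ℕ :=
  sInf {n : ℕ | ∃ c : V → Fin n, NonrepColoring G c}

/-- The Thue–Morse sequence: the parity of the binary digit sum. -/
def thueMorse (n : ℕ) : ℕ := (Nat.digits 2 n).sum % 2

lemma thueMorse_lt_two (n : ℕ) : thueMorse n < 2 := Nat.mod_lt _ two_pos

lemma thueMorse_two_mul (n : ℕ) : thueMorse (2 * n) = thueMorse n := by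
  rcases Nat.eq_zero_or_pos n with rfl | hn
  · rfl
  · simp [thueMorse, Nat.digits_def' (b := 2) one_lt_two (show 0 < 2 * n by omega)]

lemma thueMorse_two_mul_add_one (n : ℕ) : thueMorse (2 * n + 1) = 1 - thueMorse n := by
  have h : (2 * n + 1) / 2 = n := by omega
  have h' : (2 * n + 1) % 2 = 1 := by omega
  simp only [thueMorse, Nat.digits_def' (b := 2) one_lt_two (show 0 < 2 * n + 1 by omega), h, h',
    List.sum_cons]
  omega

lemma thueMorse_ne_succ_of_even (n : ℕ) : thueMorse (2 * n) ≠ thueMorse (2 * n + 1) := by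
  have := thueMorse_lt_two n
  rw [thueMorse_two_mul, thueMorse_two_mul_add_one]
  omega

lemma thueMorse_four_mul_add_one (n : ℕ) : thueMorse (4 * n + 1) = thueMorse (4 * n + 2) := by
  rw [show 4 * n + 1 = 2 * (2 * n) + 1 by ring, show 4 * n + 2 = 2 * (2 * n + 1) by ring,
    thueMorse_two_mul_add_one, thueMorse_two_mul, thueMorse_two_mul, thueMorse_two_mul_add_one]

/-- The Thue–Morse sequence is overlap-free. -/
theorem thueMorse_overlap_free (p : ℕ) (hp : 0 < p) (n : ℕ) :
    ¬ ∀ i ≤ p, thueMorse (n + i) = thueMorse (n + p + i) := by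
  induction p using Nat.strong_induction_on generalizing n with
  | _ p ih =>
  intro h
  obtain ⟨q, rfl | rfl⟩ := Nat.even_or_odd' p
  · refine ih q (by omega) (by omega) (n / 2) fun j hj => ?_
    have hj' := h (2 * j) (by omega)
    obtain ⟨m, rfl | rfl⟩ := Nat.even_or_odd' n
    · rw [show 2 * m + 2 * j = 2 * (m + j) by ring,
        show 2 * m + 2 * q + 2 * j = 2 * (m + q + j) by ring, thueMorse_two_mul,
        thueMorse_two_mul] at hj'
      rwa [show 2 * m / 2 = m by omega]
    · rw [show 2 * m + 1 + 2 * j = 2 * (m + j) + 1 by ring,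
        show 2 * m + 1 + 2 * q + 2 * j = 2 * (m + q + j) + 1 by ring, thueMorse_two_mul_add_one,
        thueMorse_two_mul_add_one] at hj'
      rw [show (2 * m + 1) / 2 = m by omega]
      have := thueMorse_lt_two (m + j)
      have := thueMorse_lt_two (m + q + j)
      omega
  · have alternates (i : ℕ) (hi : i < 2 * q + 1) :
        thueMorse (n + i) ≠ thueMorse (n + i + 1) ∧
          thueMorse (n + (2 * q + 1) + i) ≠ thueMorse (n + (2 * q + 1) + i + 1) := by
      have h₁ := h i (by omega)
      have h₂ := h (i + 1) (by omega)
      rw [← add_assoc, ← add_assoc] at h₂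
      obtain ⟨m, hm | hm⟩ := Nat.even_or_odd' (n + i)
      · have := thueMorse_ne_succ_of_even m
        rw [← hm] at this
        exact ⟨this, by rwa [← h₁, ← h₂]⟩
      · have := thueMorse_ne_succ_of_even (m + q + 1)
        rw [show 2 * (m + q + 1) = n + (2 * q + 1) + i by omega] at this
        exact ⟨by rwa [h₁, h₂], this⟩
    rcases Nat.eq_zero_or_pos q with rfl | hq
    · exact (alternates 0 (by omega)).1 (h 0 (by omega))
    · obtain ⟨k, i, hi, hk⟩ : ∃ k i, i < 4 ∧ n + i = 4 * k + 1 :=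
        ⟨(n + 2) / 4, 4 * ((n + 2) / 4) + 1 - n, by omega, by omega⟩
      have hk' := thueMorse_four_mul_add_one k
      by_cases hiq : i < 2 * q + 1
      · have := (alternates i hiq).1
        rw [hk] at this
        exact this hk'
      · have := (alternates (i - (2 * q + 1)) (by omega)).2
        rw [show n + (2 * q + 1) + (i - (2 * q + 1)) = 4 * k + 1 by omega] at this
        exact this hk'

/-- A sequence is square-free if no nonempty block is immediately followed by a copy of itself. -/
def SquareFreeSeq {α : Type*} (s : ℕ → α) : Prop :=
  ∀ p, 0 < p → ∀ n, ¬ ∀ i < p, s (n + i) = s (n + p + i)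

lemma SquareFreeSeq.ne_succ {α : Type*} {s : ℕ → α} (hs : SquareFreeSeq s) (n : ℕ) :
    s n ≠ s (n + 1) := by
  intro h
  refine hs 1 one_pos n fun i hi => ?_
  obtain rfl : i = 0 := by omega
  exact h

/-- The ternary sequence of (shifted) differences of the Thue–Morse sequence. -/
def ternaryThue (n : ℕ) : ℕ := thueMorse (n + 1) + 1 - thueMorse n

lemma ternaryThue_lt_three (n : ℕ) : ternaryThue n < 3 := by
  have := thueMorse_lt_two (n + 1)
  unfold ternaryThue
  omega

theorem squareFreeSeq_ternaryThue : SquareFreeSeq ternaryThue := by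
  intro p hp n h
  have shift (i : ℕ) (hi : i ≤ p) :
      thueMorse (n + i) + thueMorse (n + p) = thueMorse (n + p + i) + thueMorse n := by
    induction i with
    | zero => simp [add_comm]
    | succ i ih =>
      have h₁ := ih (by omega)
      have h₂ := h i (by omega)
      have := thueMorse_lt_two (n + i)
      have := thueMorse_lt_two (n + p + i)
      unfold ternaryThue at h₂
      rw [← add_assoc, ← add_assoc]
      omega
  have := thueMorse_lt_two n
  have := thueMorse_lt_two (n + p)
  have := thueMorse_lt_two (n + p + p)
  have := shift p le_rfl
  refine thueMorse_overlap_free p hp n fun i hi => ?_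
  have := shift i hi
  omega

/-- The ternary square-free sequence with the letter `3` inserted after every second term. -/
def markedThue (n : ℕ) : ℕ := if n % 3 = 2 then 3 else ternaryThue (2 * (n / 3) + n % 3)

lemma markedThue_lt_four (n : ℕ) : markedThue n < 4 := by
  unfold markedThue
  have := ternaryThue_lt_three (2 * (n / 3) + n % 3)
  split_ifs <;> omega

lemma markedThue_eq_three_iff (n : ℕ) : markedThue n = 3 ↔ n % 3 = 2 := by
  unfold markedThue
  have := ternaryThue_lt_three (2 * (n / 3) + n % 3)
  split_ifs <;> omega

lemma markedThue_position (b : ℕ) : markedThue (3 * (b / 2) + b % 2) = ternaryThue b := by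
  unfold markedThue
  rw [if_neg (by omega)]
  congr 1
  omega

lemma markedThue_ne_add_two (n : ℕ) : markedThue n ≠ markedThue (n + 2) := by
  intro h
  have h₀ := markedThue_eq_three_iff n
  have h₂ := markedThue_eq_three_iff (n + 2)
  have hn : n % 3 = 1 := by omega
  have e₀ := markedThue_position (2 * (n / 3) + 1)
  have e₂ := markedThue_position (2 * (n / 3) + 1 + 1)
  rw [show 3 * ((2 * (n / 3) + 1) / 2) + (2 * (n / 3) + 1) % 2 = n by omega] at e₀
  rw [show 3 * ((2 * (n / 3) + 1 + 1) / 2) + (2 * (n / 3) + 1 + 1) % 2 = n + 2 by omega] at e₂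
  exact squareFreeSeq_ternaryThue.ne_succ _ (e₀.symm.trans (h.trans e₂))

theorem squareFreeSeq_markedThue : SquareFreeSeq markedThue := by
  intro p hp n h
  obtain rfl | rfl | hp3 : p = 1 ∨ p = 2 ∨ 3 ≤ p := by omega
  · have h := h 0 one_pos
    simp only [add_zero] at h
    have h₀ := markedThue_eq_three_iff n
    have h₁ := markedThue_eq_three_iff (n + 1)
    have hn : n % 3 = 0 := by omega
    have e₀ := markedThue_position (2 * (n / 3))
    have e₁ := markedThue_position (2 * (n / 3) + 1)
    rw [show 3 * ((2 * (n / 3)) / 2) + (2 * (n / 3)) % 2 = n by omega] at e₀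
    rw [show 3 * ((2 * (n / 3) + 1) / 2) + (2 * (n / 3) + 1) % 2 = n + 1 by omega] at e₁
    exact squareFreeSeq_ternaryThue.ne_succ _ (e₀.symm.trans (h.trans e₁))
  · exact markedThue_ne_add_two n (h 0 two_pos)
  · obtain ⟨q, rfl⟩ : 3 ∣ p := by
      have h := h (2 - n % 3) (by omega)
      have h₀ := markedThue_eq_three_iff (n + (2 - n % 3))
      have h₁ := markedThue_eq_three_iff (n + p + (2 - n % 3))
      omega
    refine squareFreeSeq_ternaryThue (2 * q) (by omega) (2 * (n / 3) + min (n % 3) 2)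
      fun j hj => ?_
    set a := 2 * (n / 3) + min (n % 3) 2 with ha
    have h := h (3 * ((a + j) / 2) + (a + j) % 2 - n) (by omega)
    rw [← markedThue_position, ← markedThue_position (a + 2 * q + j)]
    convert h using 2 <;> omega

/-- A V-shaped sequence of indices, descending before `k` and ascending after it, does not read a
repetition of half-length `t` off a square-free sequence without factors `xyx`, provided that the
turn lies in the first half. -/
lemma no_repetition_of_turn_lt {α : Type*} {s : ℕ → α} (hs : SquareFreeSeq s)
    (hpal : ∀ n, s n ≠ s (n + 2)) {t k m : ℕ} (hk : k < t)
    (h : ∀ i < t, s (m + (i - k) + (k - i)) = s (m + (i + t - k) + (k - (i + t)))) : False := by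
  rcases Nat.eq_zero_or_pos k with rfl | hk0
  · refine hs t hk m fun i hi => ?_
    convert h i hi using 2 <;> omega
  · by_cases hkt : k + 1 < t
    · have h₁ := h (k - 1) (by omega)
      have h₂ := h (k + 1) (by omega)
      refine hpal (m + t - 1) ?_
      rw [show m + (k - 1 - k) + (k - (k - 1)) = m + 1 by omega,
        show m + (k - 1 + t - k) + (k - (k - 1 + t)) = m + t - 1 by omega] at h₁
      rw [show m + (k + 1 - k) + (k - (k + 1)) = m + 1 by omega,
        show m + (k + 1 + t - k) + (k - (k + 1 + t)) = m + t - 1 + 2 by omega] at h₂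
      exact h₁.symm.trans h₂
    · obtain rfl : t = k + 1 := by omega
      obtain ⟨q, rfl | rfl⟩ := Nat.even_or_odd' k
      · have h := h q (by omega)
        refine hs.ne_succ (m + q) ?_
        convert h using 2 <;> omega
      · have h := h (q + 1) (by omega)
        refine hpal (m + q) ?_
        convert h using 2 <;> omega

/-- The previous lemma without any restriction on the position of the turn. -/
lemma no_repetition_of_turn {α : Type*} {s : ℕ → α} (hs : SquareFreeSeq s)
    (hpal : ∀ n, s n ≠ s (n + 2)) {t k m : ℕ} (hk : k < 2 * t)
    (h : ∀ i < t, s (m + (i - k) + (k - i)) = s (m + (i + t - k) + (k - (i + t)))) : False := by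
  by_cases hkt : k < t
  · exact no_repetition_of_turn_lt hs hpal hkt h
  · refine no_repetition_of_turn_lt hs hpal (t := t) (k := 2 * t - 1 - k) (m := m) (by omega)
      fun i hi => ?_
    have h := (h (t - 1 - i) (by omega)).symm
    convert h using 2 <;> omega

/-- A sequence with steps `±1` that never descends after an ascent is V-shaped. -/
lemma exists_turn {d : ℕ → ℕ} (n : ℕ)
    (hstep : ∀ i < n, d (i + 1) = d i + 1 ∨ d i = d (i + 1) + 1)
    (hpeak : ∀ i, i + 1 < n → d (i + 1) = d i + 1 → d (i + 2) = d (i + 1) + 1) :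
    ∃ k ≤ n, ∃ m, ∀ i ≤ n, d i = m + (i - k) + (k - i) := by
  induction n with
  | zero => exact ⟨0, le_rfl, d 0, fun i hi => by simp [Nat.le_zero.1 hi]⟩
  | succ n ih =>
    obtain ⟨k, hk, m, h⟩ := ih (fun i hi => hstep i (by omega)) fun i hi => hpeak i (by omega)
    have hn := h n le_rfl
    rcases hstep n (by omega) with hup | hdown
    · refine ⟨k, by omega, m, fun i hi => ?_⟩
      rcases Nat.le_add_one_iff.1 hi with hi | rfl
      · exact h i hi
      · rw [hup]
        omega
    · obtain rfl : k = n := by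
        by_contra hkn
        obtain ⟨l, rfl⟩ : ∃ l, n = l + 1 := ⟨n - 1, by omega⟩
        have hl := h l (by omega)
        have := hpeak l (by omega) (by omega)
        rw [show l + 1 + 1 = l + 2 from rfl] at hdown
        omega
      refine ⟨k + 1, le_rfl, m - 1, fun i hi => ?_⟩
      rcases Nat.le_add_one_iff.1 hi with hi | rfl
      · have := h i hi
        omega
      · omega

namespace SimpleGraph

variable {V : Type*} {G : SimpleGraph V}

/-- In a tree, a vertex has at most one neighbor closer to a given root. -/
lemma IsTree.eq_of_adj_of_dist_add_one (hG : G.IsTree) {r a b v : V} (ha : G.Adj a v)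
    (hb : G.Adj b v) (hda : G.dist r v = G.dist r a + 1) (hdb : G.dist r v = G.dist r b + 1) :
    a = b := by
  obtain ⟨p, hp⟩ := hG.connected.exists_walk_length_eq_dist r a
  obtain ⟨q, hq⟩ := hG.connected.exists_walk_length_eq_dist r b
  have hp' : (p.concat ha).IsPath :=
    Walk.isPath_of_length_eq_dist _ (by rw [Walk.length_concat, hp, hda])
  have hq' : (q.concat hb).IsPath :=
    Walk.isPath_of_length_eq_dist _ (by rw [Walk.length_concat, hq, hdb])
  have h := congrArg (fun w => w.1.penultimate)
    ((hG.isAcyclic.subsingleton_path r v).elim ⟨_, hp'⟩ ⟨_, hq'⟩)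
  simpa using h

lemma IsTree.dist_step (hG : G.IsTree) (r : V) {a b : V} (h : G.Adj a b) :
    G.dist r b = G.dist r a + 1 ∨ G.dist r a = G.dist r b + 1 := by
  have h₁ := hG.dist_ne_of_adj r h
  have h₂ := h.diff_dist_adj (u := r)
  omega

end SimpleGraph

/-- Colouring the vertices of a tree according to their distance to a root, along a square-free
sequence without factors `xyx`, is nonrepetitive. -/
theorem nonrepColoring_dist {V α : Type*} {T : SimpleGraph V} (hT : T.IsTree) (r : V) {s : ℕ → α}
    (hs : SquareFreeSeq s) (hpal : ∀ n, s n ≠ s (n + 2)) :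
    NonrepColoring T fun v => s (T.dist r v) := by
  rintro u v p hp ⟨w, hw, h⟩
  have hwpos : 0 < w.length := List.length_pos_of_ne_nil hw
  have hlen : p.length + 1 = 2 * w.length := by
    have := congrArg List.length h
    simp only [List.length_map, SimpleGraph.Walk.length_support, List.length_append] at this
    omega
  obtain ⟨k, hk, m, hd⟩ := exists_turn (d := fun i => T.dist r (p.getVert i)) p.length
    (fun i hi => hT.dist_step r (p.adj_getVert_succ hi)) (fun i hi hup => by
      refine (hT.dist_step r (p.adj_getVert_succ hi)).resolve_right fun hdown => ?_
      have := hT.eq_of_adj_of_dist_add_one (p.adj_getVert_succ (by omega : i < p.length))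
        (p.adj_getVert_succ hi).symm hup hdown
      have := hp.getVert_injOn (by simp; omega) (by simp; omega) this
      omega)
  have hcol (i : ℕ) (hi : i ≤ p.length) :
      (w ++ w)[i]? = some (s (m + (i - k) + (k - i))) := by
    rw [← h, List.getElem?_map, ← p.getVert_eq_support_getElem? hi, ← hd i hi]
    rfl
  refine no_repetition_of_turn hs hpal (t := w.length) (k := k) (m := m) (by omega) fun i hi => ?_
  have h₁ := hcol i (by omega)
  have h₂ := hcol (i + w.length) (by omega)
  rw [List.getElem?_append_left hi] at h₁
  rw [List.getElem?_append_right (by omega), Nat.add_sub_cancel] at h₂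
  exact Option.some_injective _ (h₁.symm.trans h₂)

theorem exists_nonrepColoring_four {V : Type*} {T : SimpleGraph V} (hT : T.IsTree) :
    ∃ c : V → Fin 4, NonrepColoring T c := by
  obtain ⟨r⟩ := hT.connected.nonempty
  refine ⟨_, nonrepColoring_dist hT r (s := fun n => ⟨markedThue n, markedThue_lt_four n⟩) ?_ ?_⟩
  · intro p hp n h
    exact squareFreeSeq_markedThue p hp n fun i hi => congrArg Fin.val (h i hi)
  · intro n h
    exact markedThue_ne_add_two n (congrArg Fin.val h)

section LowerBound

variable {V α : Type*} {G : SimpleGraph V} {c : V → α}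

lemma NonrepColoring.ne_of_adj (hc : NonrepColoring G c) {a b : V} (h : G.Adj a b) :
    c a ≠ c b := by
  intro e
  refine hc a b (.cons h .nil) (by simp [h.ne]) ⟨[c a], by simp, by simp [e]⟩

/-- There is no two-coloured path on four vertices. -/
lemma NonrepColoring.ne_of_path_four (hc : NonrepColoring G c) {x a b d : V} (hxa : G.Adj x a)
    (hab : G.Adj a b) (hbd : G.Adj b d) (hnd : [x, a, b, d].Nodup) (h : c a = c d) :
    c x ≠ c b := by
  intro e
  exact hc x d (.cons hxa (.cons hab (.cons hbd .nil)))
    ((SimpleGraph.Walk.isPath_def _).2 (by simpa using hnd)) ⟨[c x, c a], by simp, by simp [e, h]⟩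

/-- With three colours, the two neighbors `w`, `w'` of `v` cannot have the same colour as soon as
a long enough caterpillar hangs off `w`. -/
lemma NonrepColoring.ne_of_caterpillar {c : V → ℕ} (hc : NonrepColoring G c) (hc3 : ∀ a, c a < 3)
    {v w w' x x' y y' z z' u : V} (hnd : [v, w, w', x, x', y, y', z, z', u].Nodup)
    (hvw : G.Adj v w) (hvw' : G.Adj v w') (hwx : G.Adj w x) (hwx' : G.Adj w x') (hxy : G.Adj x y)
    (hxy' : G.Adj x y') (hyz : G.Adj y z) (hyz' : G.Adj y z') (hzu : G.Adj z u) :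
    c w ≠ c w' := by
  intro hww
  simp only [List.nodup_cons, List.mem_cons, List.not_mem_nil, not_or, or_false] at hnd
  have hx : c x ≠ c v := hc.ne_of_path_four hwx.symm hvw.symm hvw' (by simp; grind) hww
  have hx' : c x' ≠ c v := hc.ne_of_path_four hwx'.symm hvw.symm hvw' (by simp; grind) hww
  have hvw₀ := hc.ne_of_adj hvw
  have hwx₀ := hc.ne_of_adj hwx
  have hwx₁ := hc.ne_of_adj hwx'
  have hxy₀ := hc.ne_of_adj hxy
  have hxy₁ := hc.ne_of_adj hxy'
  have hyz₀ := hc.ne_of_adj hyz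
  have hyz₁ := hc.ne_of_adj hyz'
  have hzu₀ := hc.ne_of_adj hzu
  have := hc3 v
  have := hc3 w
  have := hc3 x
  have := hc3 x'
  have := hc3 y
  have := hc3 y'
  have := hc3 z
  have := hc3 z'
  have := hc3 u
  have hxx : c x = c x' := by omega
  have hy : c y ≠ c w := hc.ne_of_path_four hxy.symm hwx.symm hwx' (by simp; grind) hxx
  have hy' : c y' ≠ c w := hc.ne_of_path_four hxy'.symm hwx.symm hwx' (by simp; grind) hxx
  have hyv : c v = c y := by omega
  have hyy : c y = c y' := by omega
  have hz : c z ≠ c x := hc.ne_of_path_four hyz.symm hxy.symm hxy' (by simp; grind) hyy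
  have hz' : c z' ≠ c x := hc.ne_of_path_four hyz'.symm hxy.symm hxy' (by simp; grind) hyy
  have hzw : c w = c z := by omega
  have hzz : c z = c z' := by omega
  have hu : c u ≠ c y := hc.ne_of_path_four hzu.symm hyz.symm hyz' (by simp; grind) hzz
  have hux : c x = c u := by omega
  exact hc v u (.cons hvw (.cons hwx (.cons hxy (.cons hyz (.cons hzu .nil)))))
    ((SimpleGraph.Walk.isPath_def _).2 (by simp; grind))
    ⟨[c v, c w, c x], by simp, by simp [hyv, hzw, hux]⟩

lemma NonrepColoring.comp_injective (hc : NonrepColoring G c) {β : Type*} {f : α → β}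
    (hf : f.Injective) : NonrepColoring G (f ∘ c) := by
  rintro u v p hp ⟨w, hw, h⟩
  rw [← List.map_map] at h
  obtain ⟨l₁, l₂, hl, h₁, h₂⟩ := List.map_eq_append_iff.1 h
  obtain rfl : l₁ = l₂ := List.map_injective_iff.2 hf (h₁.trans h₂.symm)
  refine hc u v p hp ⟨l₁, ?_, hl⟩
  rintro rfl
  exact hw h₁.symm

end LowerBound

/-- The graph on `Fin (n + 1)` joining every nonzero vertex to its parent. -/
def parentGraph {n : ℕ} (f : Fin n → Fin (n + 1)) : SimpleGraph (Fin (n + 1)) :=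
  SimpleGraph.fromEdgeSet (Set.range fun i => s(i.succ, f i))

lemma parentGraph_adj {n : ℕ} {f : Fin n → Fin (n + 1)} (hf : ∀ i, f i < i.succ) (i : Fin n) :
    (parentGraph f).Adj (f i) i.succ := by
  rw [parentGraph, SimpleGraph.fromEdgeSet_adj]
  exact ⟨⟨i, Sym2.eq_swap⟩, (hf i).ne⟩

lemma isTree_parentGraph {n : ℕ} {f : Fin n → Fin (n + 1)} (hf : ∀ i, f i < i.succ) :
    (parentGraph f).IsTree := by
  have hreach (v : Fin (n + 1)) : (parentGraph f).Reachable 0 v := by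
    induction v using WellFoundedLT.induction with
    | _ v ih =>
    cases v using Fin.cases with
    | zero => rfl
    | succ i => exact (ih _ (hf i)).trans (parentGraph_adj hf i).reachable
  have hconn : (parentGraph f).Connected :=
    (SimpleGraph.connected_iff_exists_forall_reachable _).2 ⟨0, hreach⟩
  refine SimpleGraph.isTree_iff_connected_and_card.2 ⟨hconn, ?_⟩
  have hle : Nat.card (parentGraph f).edgeSet ≤ n := by
    have hsub : (parentGraph f).edgeSet ⊆ Set.range fun i => s(i.succ, f i) := by
      rw [parentGraph, SimpleGraph.edgeSet_fromEdgeSet]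
      exact Set.sdiff_subset
    refine (Nat.card_mono (Set.finite_range _) hsub).trans ?_
    simpa using Finite.card_range_le fun i : Fin n => s(i.succ, f i)
  have hge := hconn.card_vert_le_card_edgeSet_add_one
  simp only [Nat.card_eq_fintype_card, Fintype.card_fin] at hge hle ⊢
  omega

/-- Parents in a tree on 18 vertices whose root has the three children `1`, `2` and `3`; a
caterpillar hangs off each of `1` and `2`. -/
def caterpillarParent : Fin 17 → Fin 18 :=
  ![0, 0, 0, 1, 1, 4, 4, 6, 6, 8, 2, 2, 11, 11, 13, 13, 15]

lemma caterpillarParent_lt (i : Fin 17) : caterpillarParent i < i.succ := by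
  revert i
  decide

lemma not_nonrepColoring_three {c : Fin 18 → ℕ} (hc3 : ∀ a, c a < 3) :
    ¬ NonrepColoring (parentGraph caterpillarParent) c := by
  intro hc
  have adj := parentGraph_adj caterpillarParent_lt
  have h₁₂ : c 1 ≠ c 2 := hc.ne_of_caterpillar hc3
    (v := 0) (x := 4) (x' := 5) (y := 6) (y' := 7) (z := 8) (z' := 9) (u := 10) (by decide)
    (adj 0) (adj 1) (adj 3) (adj 4) (adj 5) (adj 6) (adj 7) (adj 8) (adj 9)
  have h₁₃ : c 1 ≠ c 3 := hc.ne_of_caterpillar hc3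
    (v := 0) (x := 4) (x' := 5) (y := 6) (y' := 7) (z := 8) (z' := 9) (u := 10) (by decide)
    (adj 0) (adj 2) (adj 3) (adj 4) (adj 5) (adj 6) (adj 7) (adj 8) (adj 9)
  have h₂₃ : c 2 ≠ c 3 := hc.ne_of_caterpillar hc3
    (v := 0) (x := 11) (x' := 12) (y := 13) (y' := 14) (z := 15) (z' := 16) (u := 17) (by decide)
    (adj 1) (adj 2) (adj 10) (adj 11) (adj 12) (adj 13) (adj 14) (adj 15) (adj 16)
  have h₀₁ : c 0 ≠ c 1 := hc.ne_of_adj (adj 0)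
  have h₀₂ : c 0 ≠ c 2 := hc.ne_of_adj (adj 1)
  have h₀₃ : c 0 ≠ c 3 := hc.ne_of_adj (adj 2)
  have := hc3 0
  have := hc3 1
  have := hc3 2
  have := hc3 3
  omega

lemma thueNumber_le_four {V : Type*} {T : SimpleGraph V} (hT : T.IsTree) : thueNumber T ≤ 4 :=
  Nat.sInf_le (exists_nonrepColoring_four hT)

/-- **Brešar–Grytczuk–Klavžar–Niwczyk–Peterin.** If `T` is a tree then `π(T) ≤ 4`,
and the bound is tight: there is a tree with Thue chromatic number exactly `4`. -/
theorem thueNumber_tree_le_four :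
    (∀ (V : Type) (_ : Fintype V) (_ : DecidableEq V) (T : SimpleGraph V),
      T.IsTree → thueNumber T ≤ 4) ∧
    (∃ (V : Type) (_ : Fintype V) (_ : DecidableEq V) (T : SimpleGraph V),
      T.IsTree ∧ thueNumber T = 4) := by
  have hT := isTree_parentGraph caterpillarParent_lt
  refine ⟨fun V _ _ T hT => thueNumber_le_four hT, Fin 18, inferInstance, inferInstance,
    parentGraph caterpillarParent, hT, (thueNumber_le_four hT).antisymm ?_⟩
  refine le_csInf ⟨4, exists_nonrepColoring_four hT⟩ ?_
  rintro n ⟨c, hc⟩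
  by_contra! hn
  exact not_nonrepColoring_three (fun a => (c a).is_lt.trans_le (by omega))
    (hc.comp_injective Fin.val_injective)
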